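/- arXiv:1811.02734 — 2 statements merged into one kernel-verified Lean document; each statement's English description precedes it below -/
import Mathlib

section
/- For every 0 ≤ n ≤ N: |Q(O_N ⋯ O_1 ρ) − Q(O_N ⋯ O_{n+1} (Π O_n Π)(Π O_{n-1} Π) ⋯ (Π O_1 Π) ρ)| ≤ N_Q N_ρ (∏_{j=n+1}^N ‖O_j‖) · (∏_{j=1}^n (‖O_j‖ + ‖δ_j‖) − ∏_{j=1}^n ‖O_j‖), where δ_j = Π O_j Π − O_j Π. -/
/-- `seqRangeL O a b` is the composition `O_{b-1} ∘ ⋯ ∘ O_{a+1} ∘ O_a` (the map `O_a` is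
applied first); for `b ≤ a` it is the identity. -/
def seqRangeL {E : Type*} [NormedAddCommGroup E] [NormedSpace ℝ E]
    (O : ℕ → E →L[ℝ] E) (a b : ℕ) : E →L[ℝ] E :=
  (List.range' a (b - a)).foldl (fun acc j => (O j).comp acc) (ContinuousLinearMap.id ℝ E)

theorem seqRangeL_self' {E : Type*} [NormedAddCommGroup E] [NormedSpace ℝ E]
    (O : ℕ → E →L[ℝ] E) (a : ℕ) : seqRangeL O a a = ContinuousLinearMap.id ℝ E := by
  simp [seqRangeL]

theorem seqRangeL_succ' {E : Type*} [NormedAddCommGroup E] [NormedSpace ℝ E]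
    (O : ℕ → E →L[ℝ] E) (a b : ℕ) (h : a ≤ b) :
    seqRangeL O a (b + 1) = (O b).comp (seqRangeL O a b) := by
  unfold seqRangeL
  rw [Nat.sub_add_comm h, List.range'_concat, List.foldl_append]
  simp [Nat.add_sub_cancel' h]

theorem seqRangeL_split {E : Type*} [NormedAddCommGroup E] [NormedSpace ℝ E]
    (O : ℕ → E →L[ℝ] E) (n N : ℕ) (h : n ≤ N) :
    seqRangeL O 0 N = (seqRangeL O n N).comp (seqRangeL O 0 n) := by
  induction N, h using Nat.le_induction with
  | base => simp [seqRangeL_self']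
  | succ m hm ih =>
    rw [seqRangeL_succ' O 0 m (Nat.zero_le _), seqRangeL_succ' O n m hm, ih]
    rfl

theorem seqRangeL_bound {E : Type*} [NormedAddCommGroup E] [NormedSpace ℝ E]
    (O : ℕ → E →L[ℝ] E) (n N : ℕ) (h : n ≤ N) (x : E) :
    ‖seqRangeL O n N x‖ ≤ (∏ j ∈ Finset.Ico n N, ‖O j‖) * ‖x‖ := by
  induction N, h using Nat.le_induction with
  | base => simp [seqRangeL_self']
  | succ m hm ih =>
    rw [seqRangeL_succ' O n m hm, Finset.prod_Ico_succ_top hm]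
    calc ‖O m (seqRangeL O n m x)‖ ≤ ‖O m‖ * ‖seqRangeL O n m x‖ := (O m).le_opNorm _
      _ ≤ ‖O m‖ * ((∏ j ∈ Finset.Ico n m, ‖O j‖) * ‖x‖) := by gcongr
      _ = _ := by ring

theorem proj_bound {E : Type*} [NormedAddCommGroup E] [NormedSpace ℝ E]
    (ρ : E) (Nρ : ℝ) (hρ : ‖ρ‖ ≤ Nρ) (O : ℕ → E →L[ℝ] E)
    (Pr : E →L[ℝ] E) (hPr : Pr.comp Pr = Pr) (hPrρ : Pr ρ = ρ) (n : ℕ) :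
    Pr (seqRangeL (fun j => Pr.comp ((O j).comp Pr)) 0 n ρ)
        = seqRangeL (fun j => Pr.comp ((O j).comp Pr)) 0 n ρ ∧
    ‖seqRangeL (fun j => Pr.comp ((O j).comp Pr)) 0 n ρ‖ ≤
      Nρ * ∏ j ∈ Finset.range n, (‖O j‖ + ‖Pr.comp ((O j).comp Pr) - (O j).comp Pr‖) ∧
    ‖seqRangeL O 0 n ρ - seqRangeL (fun j => Pr.comp ((O j).comp Pr)) 0 n ρ‖ ≤
      Nρ * ((∏ j ∈ Finset.range n, (‖O j‖ + ‖Pr.comp ((O j).comp Pr) - (O j).comp Pr‖))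
            - ∏ j ∈ Finset.range n, ‖O j‖) := by
  induction n with
  | zero => simp [seqRangeL_self', hPrρ, hρ]
  | succ n ih =>
    rw [seqRangeL_succ' _ 0 n (Nat.zero_le _), seqRangeL_succ' _ 0 n (Nat.zero_le _),
      Finset.prod_range_succ, Finset.prod_range_succ]
    obtain ⟨h1, h2, h3⟩ := ih
    set b := seqRangeL (fun j => Pr.comp ((O j).comp Pr)) 0 n ρ with hb
    set a := seqRangeL O 0 n ρ with ha
    set P := ∏ j ∈ Finset.range n, (‖O j‖ + ‖Pr.comp ((O j).comp Pr) - (O j).comp Pr‖)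
    set R := ∏ j ∈ Finset.range n, ‖O j‖
    set δ := Pr.comp ((O n).comp Pr) - (O n).comp Pr with hδ
    simp only [ContinuousLinearMap.comp_apply]
    rw [← hb, ← ha]
    have hPP : ∀ x, Pr (Pr x) = Pr x := fun x => DFunLike.congr_fun hPr x
    have hstep : Pr (O n (Pr b)) = O n b + δ b := by simp [hδ, h1]
    have hd : ‖δ b‖ ≤ ‖δ‖ * (Nρ * P) := (δ.le_opNorm b).trans (by gcongr)
    refine ⟨hPP _, ?_, ?_⟩
    · rw [hstep]
      have ho : ‖O n b‖ ≤ ‖O n‖ * (Nρ * P) := ((O n).le_opNorm b).trans (by gcongr)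
      linarith [norm_add_le (O n b) (δ b)]
    · have e : O n a - Pr (O n (Pr b)) = O n (a - b) - δ b := by
        rw [hstep, map_sub]; abel
      rw [e]
      have ho : ‖O n (a - b)‖ ≤ ‖O n‖ * (Nρ * (P - R)) :=
        ((O n).le_opNorm _).trans (by gcongr)
      linarith [norm_sub_le (O n (a - b)) (δ b)]

/-- For every `0 ≤ n ≤ N` (operations indexed `0, …, N-1` here):
`|Q(O_N ⋯ O_1 ρ) − Q(O_N ⋯ O_{n+1} (Π O_n Π) ⋯ (Π O_1 Π) ρ)|
  ≤ N_Q N_ρ (∏_{j=n+1}^N ‖O_j‖) (∏_{j=1}^n (‖O_j‖ + ‖δ_j‖) − ∏_{j=1}^n ‖O_j‖)`,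
where `δ_j = Π O_j Π − O_j Π`. -/
theorem stmt9 {E : Type*} [NormedAddCommGroup E] [NormedSpace ℝ E]
    (ρ : E) (Q : E →L[ℝ] ℝ) (Nρ NQ : ℝ) (hρ : ‖ρ‖ ≤ Nρ) (hQ : ‖Q‖ ≤ NQ)
    (N : ℕ) (O : ℕ → E →L[ℝ] E)
    (Pr : E →L[ℝ] E) (hPr : Pr.comp Pr = Pr) (hPrρ : Pr ρ = ρ) :
    ∀ n ≤ N,
      |Q (seqRangeL O 0 N ρ)
        - Q (((seqRangeL O n N).comp
            (seqRangeL (fun j => Pr.comp ((O j).comp Pr)) 0 n)) ρ)|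
      ≤ NQ * Nρ * (∏ j ∈ Finset.Ico n N, ‖O j‖) *
          ((∏ j ∈ Finset.range n, (‖O j‖ + ‖Pr.comp ((O j).comp Pr) - (O j).comp Pr‖))
            - ∏ j ∈ Finset.range n, ‖O j‖) := by
  intro n hn
  have hNQ : 0 ≤ NQ := (norm_nonneg Q).trans hQ
  have h3 := (proj_bound ρ Nρ hρ O Pr hPr hPrρ n).2.2
  rw [seqRangeL_split O n N hn, ContinuousLinearMap.comp_apply, ContinuousLinearMap.comp_apply,
    ← map_sub, ← map_sub, ← Real.norm_eq_abs]
  have hR : 0 ≤ ∏ j ∈ Finset.Ico n N, ‖O j‖ := Finset.prod_nonneg fun _ _ => norm_nonneg _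
  refine (Q.le_opNorm _).trans ?_
  refine (mul_le_mul hQ ((seqRangeL_bound O n N hn _).trans
    (mul_le_mul_of_nonneg_left h3 hR)) (norm_nonneg _) hNQ).trans (le_of_eq ?_)
  ring
end

section
/- For every σ > 0 and every natural number N: ∫_ℝ (2πσ²)^{-1/2} exp(−λ²/(2σ²)) · (1 + exp(−N λ²))/2 dλ = (1 + (1 + 2Nσ²)^{-1/2})/2. In particular, the randomized-benchmarking survival probability F(N) obtained by averaging the single-gate survival probability (1 + e^{−Nλ²})/2 of N fully depolarizing-noise gates with λ-dependent rate 1 − e^{−λ²} over a centered Gaussian variable λ of variance σ² equals (1 + 1/√(1+2Nσ²))/2, a non-exponential decay in N. -/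
open MeasureTheory

/-- For every `σ > 0` and every natural number `N`:
`∫ (2πσ²)^{-1/2} exp(−λ²/(2σ²)) (1 + exp(−Nλ²))/2 dλ = (1 + (1 + 2Nσ²)^{-1/2})/2`:
the randomized-benchmarking survival probability obtained by averaging
`(1 + e^{−Nλ²})/2` over a centered Gaussian `λ` of variance `σ²` equals
`(1 + 1/√(1+2Nσ²))/2`, a non-exponential decay in `N`. -/
theorem stmt18 (σ : ℝ) (hσ : 0 < σ) (N : ℕ) :
    ∫ x : ℝ, (Real.sqrt (2 * Real.pi * σ ^ 2))⁻¹ * Real.exp (-x ^ 2 / (2 * σ ^ 2))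
        * ((1 + Real.exp (-(N : ℝ) * x ^ 2)) / 2)
      = (1 + (Real.sqrt (1 + 2 * (N : ℝ) * σ ^ 2))⁻¹) / 2 := by
  have hs : 0 < 2 * σ ^ 2 := by positivity
  have hb : 0 < 1 / (2 * σ ^ 2) := by positivity
  have hc : 0 < 1 / (2 * σ ^ 2) + (N : ℝ) := by positivity
  have hd : 0 < 1 + 2 * (N : ℝ) * σ ^ 2 := by positivity
  have hA : 0 < Real.sqrt (2 * Real.pi * σ ^ 2) := by positivity
  have h1 : ∀ x : ℝ, (Real.sqrt (2 * Real.pi * σ ^ 2))⁻¹ * Real.exp (-x ^ 2 / (2 * σ ^ 2))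
        * ((1 + Real.exp (-(N : ℝ) * x ^ 2)) / 2)
      = ((Real.sqrt (2 * Real.pi * σ ^ 2))⁻¹ / 2) * (Real.exp (-(1 / (2 * σ ^ 2)) * x ^ 2)
        + Real.exp (-(1 / (2 * σ ^ 2) + (N : ℝ)) * x ^ 2)) := by
    intro x
    have e1 : -(1 / (2 * σ ^ 2) + (N : ℝ)) * x ^ 2
        = -(1 / (2 * σ ^ 2)) * x ^ 2 + -(N : ℝ) * x ^ 2 := by ring
    have e2 : -x ^ 2 / (2 * σ ^ 2) = -(1 / (2 * σ ^ 2)) * x ^ 2 := by ring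
    rw [e1, e2, Real.exp_add]
    ring
  simp_rw [h1]
  rw [integral_const_mul, integral_add (integrable_exp_neg_mul_sq hb)
    (integrable_exp_neg_mul_sq hc), integral_gaussian, integral_gaussian]
  have e3 : Real.pi / (1 / (2 * σ ^ 2)) = 2 * Real.pi * σ ^ 2 := by
    field_simp
  have e4 : Real.pi / (1 / (2 * σ ^ 2) + (N : ℝ))
      = (2 * Real.pi * σ ^ 2) / (1 + 2 * (N : ℝ) * σ ^ 2) := by
    rw [div_eq_div_iff hc.ne' hd.ne']
    field_simp
  rw [e3, e4, Real.sqrt_div (by positivity)]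
  have hB : 0 < Real.sqrt (1 + 2 * (N : ℝ) * σ ^ 2) := by positivity
  generalize Real.sqrt (2 * Real.pi * σ ^ 2) = A at *
  generalize Real.sqrt (1 + 2 * (N : ℝ) * σ ^ 2) = B at *
  field_simp
end
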